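/- With the Q-polynomial distance-regular graph setup, let W be an irreducible T-module with endpoint ρ, dual endpoint τ, and diameter d. Then ρ, τ, d are nonnegative integers with ρ + d ≤ D and τ + d ≤ D. Moreover: (i) E*_iW ≠ 0 if and only if ρ ≤ i ≤ ρ + d (0 ≤ i ≤ D); (ii) W = E*_ρW + E*_{ρ+1}W + ⋯ + E*_{ρ+d}W is an orthogonal direct sum; (iii) E_iW ≠ 0 if and only if τ ≤ i ≤ τ + d (0 ≤ i ≤ D); (iv) W = E_τW + E_{τ+1}W + ⋯ + E_{τ+d}W is an orthogonal direct sum. -/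

import Mathlib

noncomputable section

open Matrix Finset
open scoped ComplexInnerProductSpace

/-- A `Q`-polynomial distance-regular graph setup: a finite connected simple graph `G` on `X`
with diameter `D ≥ 3`, intersection numbers `p h i j`, primitive idempotents
`E 0, …, E D` of the Bose–Mesner algebra with (distinct, real) eigenvalues `θ 0, …, θ D`,
and Krein parameters `q h i j` satisfying the `Q`-polynomial condition with respect to the
ordering `E 0, …, E D`. -/
structure QPolyDRG (X : Type*) [Fintype X] [DecidableEq X] where
  G : SimpleGraph X
  conn : G.Connected
  D : ℕ
  hD3 : 3 ≤ D
  dist_le : ∀ y z : X, G.dist y z ≤ D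
  dist_eq : ∃ y z : X, G.dist y z = D
  p : ℕ → ℕ → ℕ → ℕ
  hp : ∀ h i j : ℕ, h ≤ D → i ≤ D → j ≤ D → ∀ y z : X, G.dist y z = h →
    Nat.card {w : X // G.dist y w = i ∧ G.dist w z = j} = p h i j
  E : ℕ → Matrix X X ℂ
  θ : ℕ → ℝ
  q : ℕ → ℕ → ℕ → ℝ
  hE0 : E 0 = ((Fintype.card X : ℂ))⁻¹ • Matrix.of (fun _ _ => (1 : ℂ))
  hEsum : ∑ i ∈ Finset.range (D + 1), E i = 1
  hEmul : ∀ i ≤ D, ∀ j ≤ D, E i * E j = if i = j then E i else 0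
  hEsym : ∀ i ≤ D, (E i)ᵀ = E i
  hEreal : ∀ i ≤ D, ∀ y z : X, ((E i) y z).im = 0
  hEinM : ∀ i ≤ D, E i ∈ Submodule.span ℂ
    {B : Matrix X X ℂ | ∃ k ≤ D, B = Matrix.of (fun y z => if G.dist y z = k then (1 : ℂ) else 0)}
  hAE : ∀ i ≤ D,
    Matrix.of (fun y z => if G.dist y z = 1 then (1 : ℂ) else 0) * E i = (θ i : ℂ) • E i
  θ_inj : ∀ i ≤ D, ∀ j ≤ D, θ i = θ j → i = j
  hKrein : ∀ i ≤ D, ∀ j ≤ D, Matrix.hadamard (E i) (E j) =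
    ((Fintype.card X : ℂ))⁻¹ • ∑ h ∈ Finset.range (D + 1), (q h i j : ℂ) • E h
  hq_zero : ∀ h ≤ D, ∀ i ≤ D, ∀ j ≤ D, (i + j < h ∨ h + j < i ∨ h + i < j) → q h i j = 0
  hq_ne : ∀ h ≤ D, ∀ i ≤ D, ∀ j ≤ D, (h = i + j ∨ i = h + j ∨ j = h + i) → q h i j ≠ 0

namespace QPolyDRG

variable {X : Type*} [Fintype X] [DecidableEq X] (S : QPolyDRG X) (x : X)

/-- The `i`-th distance matrix `A_i`. -/
def Amat (i : ℕ) : Matrix X X ℂ :=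
  Matrix.of (fun y z => if S.G.dist y z = i then (1 : ℂ) else 0)

/-- The adjacency matrix `A = A_1`. -/
def adj : Matrix X X ℂ := S.Amat 1

/-- The `i`-th dual idempotent `E*_i = E*_i(x)` with respect to the base vertex `x`. -/
def Estar (i : ℕ) : Matrix X X ℂ :=
  Matrix.diagonal (fun y => if S.G.dist x y = i then (1 : ℂ) else 0)

/-- The dual adjacency matrix `A* = A*(x)`, with `(A*)_{yy} = |X| (E_1)_{xy}`. -/
def Astar : Matrix X X ℂ :=
  Matrix.diagonal (fun y => (Fintype.card X : ℂ) * S.E 1 x y)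

/-- The subspace `E_i V` of the standard module, with the convention that it is `0`
for `i ∉ {0, …, D}`. -/
def EV (i : ℤ) : Submodule ℂ (EuclideanSpace ℂ X) :=
  if 0 ≤ i ∧ i ≤ S.D then LinearMap.range (Matrix.toEuclideanLin (S.E i.toNat)) else ⊥

/-- The `i`-th subconstituent `E*_i V` with respect to `x`, with the convention that it is `0`
for `i ∉ {0, …, D}`. -/
def EstarV (i : ℤ) : Submodule ℂ (EuclideanSpace ℂ X) :=
  if 0 ≤ i ∧ i ≤ S.D then LinearMap.range (Matrix.toEuclideanLin (S.Estar x i.toNat)) else ⊥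

/-- The subconstituent (Terwilliger) algebra `T = T(x)`, generated by `A` and `A*`. -/
def Talg : Subalgebra ℂ (Matrix X X ℂ) := Algebra.adjoin ℂ {S.adj, S.Astar x}

/-- A `T`-module: a subspace `W ⊆ V` with `B W ⊆ W` for all `B ∈ T`. -/
def IsTModule (W : Submodule ℂ (EuclideanSpace ℂ X)) : Prop :=
  ∀ B ∈ S.Talg x, ∀ w ∈ W, Matrix.toEuclideanLin B w ∈ W

/-- An irreducible `T`-module. -/
def IsIrredTModule (W : Submodule ℂ (EuclideanSpace ℂ X)) : Prop :=
  S.IsTModule x W ∧ W ≠ ⊥ ∧ ∀ W' ≤ W, S.IsTModule x W' → W' = ⊥ ∨ W' = W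

/-- The subspace `E_i W`, with the convention that it is `0` for `i ∉ {0, …, D}`. -/
def EW (W : Submodule ℂ (EuclideanSpace ℂ X)) (i : ℤ) : Submodule ℂ (EuclideanSpace ℂ X) :=
  if 0 ≤ i ∧ i ≤ S.D then Submodule.map (Matrix.toEuclideanLin (S.E i.toNat)) W else ⊥

/-- The subspace `E*_i W`, with the convention that it is `0` for `i ∉ {0, …, D}`. -/
def EstarW (W : Submodule ℂ (EuclideanSpace ℂ X)) (i : ℤ) : Submodule ℂ (EuclideanSpace ℂ X) :=
  if 0 ≤ i ∧ i ≤ S.D then Submodule.map (Matrix.toEuclideanLin (S.Estar x i.toNat)) W else ⊥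


/-- The endpoint `ρ = min { i : E*_i W ≠ 0 }` of a `T`-module `W`. -/
def endpt (W : Submodule ℂ (EuclideanSpace ℂ X)) : ℕ :=
  sInf {i : ℕ | i ≤ S.D ∧ S.EstarW x W i ≠ ⊥}

/-- The dual endpoint `τ = min { i : E_i W ≠ 0 }` of a `T`-module `W`. -/
def dualEndpt (W : Submodule ℂ (EuclideanSpace ℂ X)) : ℕ :=
  sInf {i : ℕ | i ≤ S.D ∧ S.EW W i ≠ ⊥}

/-- The diameter `d = |{ i : E*_i W ≠ 0 }| - 1` of a `T`-module `W`. -/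
def diam (W : Submodule ℂ (EuclideanSpace ℂ X)) : ℕ :=
  Set.ncard {i : ℕ | i ≤ S.D ∧ S.EstarW x W i ≠ ⊥} - 1

/-- The dual diameter `|{ i : E_i W ≠ 0 }| - 1` of a `T`-module `W`. -/
def dualDiam (W : Submodule ℂ (EuclideanSpace ℂ X)) : ℕ :=
  Set.ncard {i : ℕ | i ≤ S.D ∧ S.EW W i ≠ ⊥} - 1

/-- The split subspace `W^{μν}_h` of an irreducible `T`-module `W` with endpoint `ρ`,
dual endpoint `τ` and diameter `d`.  Here `μ = false` stands for `↓` and `μ = true`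
for `↑`, and similarly for `ν`; e.g.
`W^{↓↓}_h = (E*_ρ W + ⋯ + E*_{ρ+h} W) ∩ (E_τ W + ⋯ + E_{τ+d-h} W)`. -/
def Wsplit (W : Submodule ℂ (EuclideanSpace ℂ X)) (ρ τ d : ℕ) (μ ν : Bool) (h : ℕ) :
    Submodule ℂ (EuclideanSpace ℂ X) :=
  (if μ then ⨆ k ∈ Finset.Icc (ρ + d - h) (ρ + d), S.EstarW x W k
    else ⨆ k ∈ Finset.Icc ρ (ρ + h), S.EstarW x W k) ⊓
  (if ν then ⨆ k ∈ Finset.Icc (τ + h) (τ + d), S.EW W k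
    else ⨆ k ∈ Finset.Icc τ (τ + d - h), S.EW W k)

/-- The subspace `V^{μν}_{i,j}` (interpreted as `0` if `i = -1` or `j = -1`).
Here `μ = false` stands for `↓` and `μ = true` for `↑`, and similarly for `ν`; e.g.
`V^{↓↓}_{i,j} = (E*_0 V + ⋯ + E*_i V) ∩ (E_0 V + ⋯ + E_j V)` and
`V^{↑↑}_{i,j} = (E*_D V + ⋯ + E*_{D-i} V) ∩ (E_D V + ⋯ + E_{D-j} V)`. -/
def Vsplit (μ ν : Bool) (i j : ℤ) : Submodule ℂ (EuclideanSpace ℂ X) :=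
  if 0 ≤ i ∧ 0 ≤ j then
    (if μ then ⨆ k ∈ Finset.Icc (S.D - i.toNat) S.D, S.EstarV x k
      else ⨆ k ∈ Finset.range (i.toNat + 1), S.EstarV x k) ⊓
    (if ν then ⨆ k ∈ Finset.Icc (S.D - j.toNat) S.D, S.EV k
      else ⨆ k ∈ Finset.range (j.toNat + 1), S.EV k)
  else ⊥

/-- The subspace `Ṽ^{μν}_{i,j}`: the orthogonal complement of
`V^{μν}_{i-1,j} + V^{μν}_{i,j-1}` in `V^{μν}_{i,j}` with respect to the standard
Hermitian form. -/
def tildeV (μ ν : Bool) (i j : ℕ) : Submodule ℂ (EuclideanSpace ℂ X) :=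
  S.Vsplit x μ ν i j ⊓ (S.Vsplit x μ ν ((i : ℤ) - 1) j ⊔ S.Vsplit x μ ν i ((j : ℤ) - 1))ᗮ

end QPolyDRG


structure TDS {V : Type*} [AddCommGroup V] [Module ℂ V] (D : ℕ) (A B : V →ₗ[ℂ] V)
    (P Q : ℕ → V →ₗ[ℂ] V) (θ φ : ℕ → ℂ) (W : Submodule ℂ V) : Prop where
  Psum : ∀ v, ∑ i ∈ Finset.range (D + 1), P i v = v
  Qsum : ∀ v, ∑ i ∈ Finset.range (D + 1), Q i v = v
  Pmul : ∀ i ≤ D, ∀ j ≤ D, ∀ v, P i (P j v) = if i = j then P i v else 0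
  Qmul : ∀ i ≤ D, ∀ j ≤ D, ∀ v, Q i (Q j v) = if i = j then Q i v else 0
  PA : ∀ i ≤ D, ∀ v, P i (A v) = θ i • P i v
  QB : ∀ i ≤ D, ∀ v, Q i (B v) = φ i • Q i v
  Ptri : ∀ i ≤ D, ∀ j ≤ D, (i + 1 < j ∨ j + 1 < i) → ∀ v, P i (B (P j v)) = 0
  Qtri : ∀ i ≤ D, ∀ j ≤ D, (i + 1 < j ∨ j + 1 < i) → ∀ v, Q i (A (Q j v)) = 0
  PW : ∀ i ≤ D, ∀ w ∈ W, P i w ∈ W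
  QW : ∀ i ≤ D, ∀ w ∈ W, Q i w ∈ W
  AW : ∀ w ∈ W, A w ∈ W
  BW : ∀ w ∈ W, B w ∈ W
  irr : ∀ W' ≤ W, (∀ w ∈ W', A w ∈ W') → (∀ w ∈ W', B w ∈ W') → W' = ⊥ ∨ W' = W

namespace TDS

variable {V : Type*} [AddCommGroup V] [Module ℂ V] {D : ℕ} {A B : V →ₗ[ℂ] V}
    {P Q : ℕ → V →ₗ[ℂ] V} {θ φ : ℕ → ℂ} {W : Submodule ℂ V}

theorem symm (H : TDS D A B P Q θ φ W) : TDS D B A Q P φ θ W :=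
  ⟨H.Qsum, H.Psum, H.Qmul, H.Pmul, H.QB, H.PA, H.Qtri, H.Ptri, H.QW, H.PW, H.BW, H.AW,
    fun W' h a b => H.irr W' h b a⟩

theorem ext0 (H : TDS D A B P Q θ φ W) (w : V) (h : ∀ i ≤ D, P i w = 0) : w = 0 := by
  rw [← H.Psum w]
  exact Finset.sum_eq_zero fun i hi => h i (by simpa [Nat.lt_succ_iff] using hi)

theorem PB0 (H : TDS D A B P Q θ φ W) (l : ℕ) (hl : l ≤ D) (w : V)
    (h : ∀ m ≤ D, l ≤ m + 1 → m ≤ l + 1 → P m w = 0) : P l (B w) = 0 := by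
  rw [← H.Psum w, map_sum, map_sum]
  refine Finset.sum_eq_zero fun m hm => ?_
  have hm' : m ≤ D := by simpa [Nat.lt_succ_iff] using hm
  by_cases h1 : l ≤ m + 1 ∧ m ≤ l + 1
  · rw [h m hm' h1.1 h1.2]; simp
  · exact H.Ptri l hl m hm' (by omega) w

theorem interval (H : TDS D A B P Q θ φ W) {i k j : ℕ} (hik : i < k) (hkj : k < j) (hj : j ≤ D)
    (hi0 : ∃ w ∈ W, P i w ≠ 0) (hj0 : ∃ w ∈ W, P j w ≠ 0) : ∃ w ∈ W, P k w ≠ 0 := by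
  by_contra hk
  push Not at hk
  let W' : Submodule ℂ V :=
    { carrier := {w | w ∈ W ∧ ∀ l ≤ D, k ≤ l → P l w = 0}
      zero_mem' := ⟨W.zero_mem, by simp⟩
      add_mem' := by
        rintro a b ⟨ha, ha'⟩ ⟨hb, hb'⟩
        refine ⟨W.add_mem ha hb, fun l h1 h2 => ?_⟩
        rw [map_add, ha' l h1 h2, hb' l h1 h2, add_zero]
      smul_mem' := by
        rintro c a ⟨ha, ha'⟩
        refine ⟨W.smul_mem c ha, fun l h1 h2 => ?_⟩
        rw [map_smul, ha' l h1 h2, smul_zero] }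
  have hor : W' = ⊥ ∨ W' = W := by
    refine H.irr W' (fun w hw => hw.1) ?_ ?_
    · rintro w ⟨hw, hw'⟩
      exact ⟨H.AW w hw, fun l h1 h2 => by rw [H.PA l h1, hw' l h1 h2, smul_zero]⟩
    · rintro w ⟨hw, hw'⟩
      refine ⟨H.BW w hw, fun l h1 h2 => ?_⟩
      rcases Nat.eq_or_lt_of_le h2 with h3 | h3
      · subst h3; exact hk _ (H.BW w hw)
      · exact H.PB0 l h1 w fun m h4 h5 h6 => hw' m h4 (by omega)
  rcases hor with h | h
  · obtain ⟨w, hw, hne⟩ := hi0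
    have : P i w ∈ W' := ⟨H.PW i (by omega) w hw, fun l h1 h2 => by
      rw [H.Pmul l h1 i (by omega), if_neg (by omega)]⟩
    rw [h] at this
    exact hne (by simpa using this)
  · obtain ⟨w, hw, hne⟩ := hj0
    rw [← h] at hw
    exact hne (hw.2 j hj (by omega))

/-- The space `V_{ij}`. -/
def Vij (D : ℕ) (P Q : ℕ → V →ₗ[ℂ] V) (W : Submodule ℂ V) (i j : ℕ) : Submodule ℂ V where
  carrier := {w | w ∈ W ∧ (∀ h ≤ D, i < h → Q h w = 0) ∧ ∀ k ≤ D, k < j → P k w = 0}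
  zero_mem' := ⟨W.zero_mem, by simp, by simp⟩
  add_mem' := by
    rintro a b ⟨ha, ha', ha2⟩ ⟨hb, hb', hb2⟩
    refine ⟨W.add_mem ha hb, fun l h1 h2 => ?_, fun l h1 h2 => ?_⟩
    · rw [map_add, ha' l h1 h2, hb' l h1 h2, add_zero]
    · rw [map_add, ha2 l h1 h2, hb2 l h1 h2, add_zero]
  smul_mem' := by
    rintro c a ⟨ha, ha', ha2⟩
    refine ⟨W.smul_mem c ha, fun l h1 h2 => ?_, fun l h1 h2 => ?_⟩
    · rw [map_smul, ha' l h1 h2, smul_zero]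
    · rw [map_smul, ha2 l h1 h2, smul_zero]

theorem core (H : TDS D A B P Q θ φ W) {ρ τ d : ℕ} (hτD : τ ≤ D)
    (hQ1 : ∀ h ≤ D, h < ρ → ∀ w ∈ W, Q h w = 0) (hQ2 : ∀ h ≤ D, ρ + d < h → ∀ w ∈ W, Q h w = 0)
    (hτ : ∃ w ∈ W, P τ w ≠ 0) (k : ℕ) (hk : k ≤ D) (hk0 : ∃ w ∈ W, P k w ≠ 0) : k ≤ τ + d := by
  by_contra hlt
  let U : ℕ → Submodule ℂ V := fun i => Vij D P Q W (ρ + i) (τ + i + 1)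
  have hle : ∀ i, U i ≤ ⨆ i, U i := fun i => le_iSup U i
  have hUA : ∀ i, ∀ w ∈ U i, A w - θ (τ + i + 1) • w ∈ U (i + 1) := by
    rintro i w ⟨h1, h2, h3⟩
    refine ⟨W.sub_mem (H.AW w h1) (W.smul_mem _ h1), fun h hh hi => ?_, fun l hl hi => ?_⟩
    · rw [map_sub, map_smul, h2 h hh (by omega), smul_zero, sub_zero]
      exact H.symm.PB0 h hh w fun m h4 h5 h6 => h2 m h4 (by omega)
    · rw [map_sub, map_smul, H.PA l hl]
      rcases Nat.lt_or_ge l (τ + i + 1) with h4 | h4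
      · rw [h3 l hl h4]; simp
      · obtain rfl : l = τ + i + 1 := by omega
        simp
  have hUB0 : ∀ w ∈ U 0, B w = φ ρ • w := by
    rintro w ⟨h1, h2, h3⟩
    rw [← sub_eq_zero]
    refine H.symm.ext0 _ fun h hh => ?_
    rw [map_sub, map_smul, H.QB h hh]
    rcases lt_trichotomy h ρ with h4 | h4 | h4
    · rw [hQ1 h hh h4 w h1]; simp
    · subst h4; simp
    · rw [h2 h hh (by omega)]; simp
  have hUB : ∀ i, ∀ w ∈ U (i + 1), B w - φ (ρ + (i + 1)) • w ∈ U i := by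
    rintro i w ⟨h1, h2, h3⟩
    refine ⟨W.sub_mem (H.BW w h1) (W.smul_mem _ h1), fun h hh hi => ?_, fun l hl hi => ?_⟩
    · rw [map_sub, map_smul, H.QB h hh]
      rcases Nat.eq_or_lt_of_le (show ρ + (i + 1) ≤ h by omega) with h4 | h4
      · subst h4; simp
      · rw [h2 h hh h4]; simp
    · rw [map_sub, map_smul, h3 l hl (by omega), smul_zero, sub_zero]
      exact H.PB0 l hl w fun m h4 h5 h6 => h3 m h4 (by omega)
  have hor : (⨆ i, U i) = ⊥ ∨ (⨆ i, U i) = W := by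
    refine H.irr (⨆ i, U i) (iSup_le fun i w hw => hw.1) ?_ ?_
    · intro w hw
      have : (⨆ i, U i) ≤ (⨆ i, U i).comap A := by
        refine iSup_le fun i w hw => ?_
        have := (⨆ i, U i).add_mem (hle _ (hUA i w hw)) ((⨆ i, U i).smul_mem (θ (τ + i + 1)) (hle _ hw))
        rwa [sub_add_cancel] at this
      exact this hw
    · intro w hw
      have : (⨆ i, U i) ≤ (⨆ i, U i).comap B := by
        refine iSup_le fun i w hw => ?_
        cases i with
        | zero =>
          change B w ∈ (⨆ i, U i)
          rw [hUB0 w hw]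
          exact (⨆ i, U i).smul_mem _ (hle _ hw)
        | succ i =>
          have := (⨆ i, U i).add_mem (hle _ (hUB i w hw))
            ((⨆ i, U i).smul_mem (φ (ρ + (i + 1))) (hle _ hw))
          rwa [sub_add_cancel] at this
      exact this hw
  rcases hor with h | h
  · obtain ⟨w, hw, hne⟩ := hk0
    have : P k w ∈ U d := ⟨H.PW k hk w hw, fun h hh hi => hQ2 h hh hi _ (H.PW k hk w hw),
      fun l hl hi => by rw [H.Pmul l hl k hk, if_neg (by omega)]⟩
    have := hle d this
    rw [h] at this
    exact hne (by simpa using this)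
  · obtain ⟨w, hw, hne⟩ := hτ
    have h2 : (⨆ i, U i) ≤ LinearMap.ker (P τ) :=
      iSup_le fun i w hw => hw.2.2 τ hτD (by omega)
    rw [h] at h2
    exact hne (h2 hw)

end TDS

namespace QPolyDRG

variable {X : Type*} [Fintype X] [DecidableEq X] (S : QPolyDRG X) (x : X)

theorem tl_mul (M N : Matrix X X ℂ) (v : EuclideanSpace ℂ X) :
    Matrix.toEuclideanLin (M * N) v = Matrix.toEuclideanLin M (Matrix.toEuclideanLin N v) := by
  simp [Matrix.toLpLin_apply, Matrix.mulVec_mulVec]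

theorem tl_one (v : EuclideanSpace ℂ X) :
    Matrix.toEuclideanLin (1 : Matrix X X ℂ) v = v := by
  simp

theorem E_fun (i : ℕ) (hi : i ≤ S.D) : ∃ f : ℕ → ℂ, ∀ y z, S.E i y z = f (S.G.dist y z) := by
  refine Submodule.span_induction (p := fun M _ => ∃ f : ℕ → ℂ, ∀ y z, M y z = f (S.G.dist y z))
    ?_ ?_ ?_ ?_ (S.hEinM i hi)
  · rintro M ⟨k, -, rfl⟩
    exact ⟨fun n => if n = k then 1 else 0, fun y z => rfl⟩
  · exact ⟨0, fun y z => rfl⟩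
  · rintro M N - - ⟨f, hf⟩ ⟨g, hg⟩
    exact ⟨f + g, fun y z => by simp [hf, hg]⟩
  · rintro c M - ⟨f, hf⟩
    exact ⟨c • f, fun y z => by simp [hf]⟩

theorem adj_E (i : ℕ) (hi : i ≤ S.D) : S.adj * S.E i = (S.θ i : ℂ) • S.E i := S.hAE i hi

theorem aeval_mul_E (p : Polynomial ℂ) (i : ℕ) (hi : i ≤ S.D) :
    Polynomial.aeval S.adj p * S.E i = p.eval (S.θ i : ℂ) • S.E i := by
  induction p using Polynomial.induction_on with
  | C a => simp [Algebra.algebraMap_eq_smul_one]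
  | add p q hp hq => simp [add_mul, add_smul, hp, hq]
  | monomial n a h =>
    rw [pow_succ, ← mul_assoc, map_mul, Polynomial.aeval_X, mul_assoc, adj_E _ _ hi,
      Matrix.mul_smul, h, smul_smul]
    simp
    ring_nf

theorem aeval_eq (p : Polynomial ℂ) :
    Polynomial.aeval S.adj p = ∑ i ∈ Finset.range (S.D + 1), p.eval (S.θ i : ℂ) • S.E i := by
  rw [← mul_one (Polynomial.aeval S.adj p), ← S.hEsum, Finset.mul_sum]
  exact Finset.sum_congr rfl fun i hi => S.aeval_mul_E p i (by simpa [Nat.lt_succ_iff] using hi)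

theorem E_aeval (i : ℕ) (hi : i ≤ S.D) : ∃ p : Polynomial ℂ, S.E i = Polynomial.aeval S.adj p := by
  let s := Finset.range (S.D + 1)
  have hinj : Set.InjOn (fun i => (S.θ i : ℂ)) (s : Set ℕ) := by
    intro a ha b hb hab
    simp only [s, Finset.coe_range, Set.mem_Iio, Nat.lt_succ_iff] at ha hb
    exact S.θ_inj a ha b hb (by simpa using hab)
  have his : i ∈ s := by simp [s, Nat.lt_succ_iff, hi]
  refine ⟨Lagrange.basis s (fun i => (S.θ i : ℂ)) i, ?_⟩
  rw [aeval_eq, Finset.sum_eq_single i]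
  · rw [Lagrange.eval_basis_self hinj his, one_smul]
  · intro j hj hji
    have := Lagrange.eval_basis_of_ne (v := fun i => (S.θ i : ℂ)) hji.symm hj
    exact (congrArg (· • S.E j) this).trans (zero_smul ℂ _)
  · intro h; exact absurd his h

theorem E_mem (i : ℕ) (hi : i ≤ S.D) : S.E i ∈ S.Talg x := by
  obtain ⟨p, hp⟩ := S.E_aeval i hi
  rw [hp]
  exact Algebra.adjoin_mono (by simp) (Polynomial.aeval_mem_adjoin_singleton ℂ S.adj)

theorem E_adj (i : ℕ) (hi : i ≤ S.D) : S.E i * S.adj = (S.θ i : ℂ) • S.E i := by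
  rw [← adj_E _ _ hi]
  obtain ⟨p, hp⟩ := S.E_aeval i hi
  rw [hp]
  have := Polynomial.aeval_mul (R := ℂ) S.adj (p := p) (q := Polynomial.X)
  have h2 := Polynomial.aeval_mul (R := ℂ) S.adj (p := Polynomial.X) (q := p)
  rw [Polynomial.aeval_X] at this h2
  rw [← this, ← h2, mul_comm]

theorem card_ne (S : QPolyDRG X) : (Fintype.card X : ℂ) ≠ 0 := by
  obtain ⟨y, -⟩ := S.dist_eq
  have : Nonempty X := ⟨y⟩
  exact_mod_cast Fintype.card_ne_zero

theorem E_agree (y z : X) (h : S.E 1 x y = S.E 1 x z) (i : ℕ) (hi : i ≤ S.D) :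
    S.E i x y = S.E i x z := by
  induction i using Nat.strong_induction_on with
  | _ n ih =>
    rcases n with _ | n
    · rw [S.hE0]; simp
    · have hD := S.hD3
      have hK := S.hKrein 1 (by omega) n (by omega)
      have h1 := congrFun (congrFun hK x) y
      have h2 := congrFun (congrFun hK x) z
      simp only [Matrix.hadamard_apply, Matrix.smul_apply, Matrix.sum_apply, smul_eq_mul] at h1 h2
      rw [h, ih n (by omega) (by omega), h2] at h1
      have h3 := mul_left_cancel₀ (inv_ne_zero S.card_ne) h1
      have hm : n + 1 ∈ Finset.range (S.D + 1) := by simpa using hi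
      rw [← Finset.add_sum_erase _ _ hm, ← Finset.add_sum_erase _ _ hm] at h3
      rw [Finset.sum_congr rfl (g := fun k => (S.q k 1 n : ℂ) * S.E k x y)] at h3
      · have hq : (S.q (n + 1) 1 n : ℂ) ≠ 0 := by
          exact_mod_cast S.hq_ne (n + 1) hi 1 (by omega) n (by omega) (by omega)
        exact (mul_left_cancel₀ hq (add_right_cancel h3)).symm
      · intro k hk
        simp only [Finset.mem_erase, Finset.mem_range] at hk
        rcases Nat.lt_or_ge k (n + 1) with h4 | h4
        · rw [ih k h4 (by omega)]
        · rw [S.hq_zero k (by omega) 1 (by omega) n (by omega) (by omega)]; simp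

theorem pow_agree (y z : X) (h : S.E 1 x y = S.E 1 x z) (n : ℕ) :
    (S.adj ^ n) x y = (S.adj ^ n) x z := by
  have := S.aeval_eq (Polynomial.X ^ n)
  rw [map_pow, Polynomial.aeval_X] at this
  rw [this]
  simp only [Matrix.smul_apply, Matrix.sum_apply]
  refine Finset.sum_congr rfl fun i hi => ?_
  rw [S.E_agree x y z h i (by simpa [Nat.lt_succ_iff] using hi)]

open Classical in
theorem adj_eq : S.adj = S.G.adjMatrix ℂ := by
  ext y z
  simp [adj, Amat, SimpleGraph.adjMatrix_apply]

theorem dist_le_of_agree (y z : X) (h : S.E 1 x y = S.E 1 x z) :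
    S.G.dist x z ≤ S.G.dist x y := by
  classical
  obtain ⟨w, hw⟩ := S.conn.exists_walk_length_eq_dist x y
  have h1 := S.pow_agree x y z h (S.G.dist x y)
  rw [adj_eq, SimpleGraph.adjMatrix_pow_apply_eq_card_walk,
    SimpleGraph.adjMatrix_pow_apply_eq_card_walk] at h1
  have h2 : 0 < Fintype.card {p : S.G.Walk x y | p.length = S.G.dist x y} :=
    Fintype.card_pos_iff.2 ⟨⟨w, hw⟩⟩
  have h3 : Fintype.card {p : S.G.Walk x y | p.length = S.G.dist x y}
    = Fintype.card {p : S.G.Walk x z | p.length = S.G.dist x y} := by exact_mod_cast h1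
  rw [h3] at h2
  obtain ⟨⟨p, hp⟩⟩ := Fintype.card_pos_iff.1 h2
  have := SimpleGraph.dist_le p
  simp only [Set.mem_ofPred_eq] at hp
  omega

theorem Estar_mem (i : ℕ) : S.Estar x i ∈ S.Talg x := by
  classical
  let v : X → ℂ := fun y => (Fintype.card X : ℂ) * S.E 1 x y
  let s : Finset ℂ := Finset.univ.image v
  let r : ℂ → ℂ := fun c => if ∃ y, v y = c ∧ S.G.dist x y = i then 1 else 0
  let p := Lagrange.interpolate s id r
  have hp : ∀ y, p.eval (v y) = if S.G.dist x y = i then 1 else 0 := by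
    intro y
    have := Lagrange.eval_interpolate_at_node (s := s) (v := id) (i := v y) r
      (Set.injOn_id _) (by simp [s])
    simp only [id] at this
    rw [show p.eval (v y) = r (v y) from this]
    simp only [r]
    refine if_congr ⟨?_, fun h => ⟨y, rfl, h⟩⟩ rfl rfl
    rintro ⟨z, h1, h2⟩
    have h3 := mul_left_cancel₀ S.card_ne h1
    have := S.dist_le_of_agree x _ _ h3
    have := S.dist_le_of_agree x _ _ h3.symm
    omega
  have : S.Estar x i = Polynomial.aeval (S.Astar x) p := by
    have h1 : S.Astar x = Matrix.diagonalAlgHom ℂ v := rfl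
    rw [h1, Polynomial.aeval_algHom_apply]
    change _ = Matrix.diagonal _
    unfold Estar
    congr 1
    ext y
    rw [← hp y, Polynomial.aeval_fn_apply]
    simp [Polynomial.aeval_def, Polynomial.eval₂_eq_eval_map]
  rw [this]
  exact Algebra.adjoin_mono (by simp) (Polynomial.aeval_mem_adjoin_singleton ℂ (S.Astar x))

theorem Estar_tri (i j : ℕ) (h : i + 1 < j ∨ j + 1 < i) :
    S.Estar x i * (S.adj * S.Estar x j) = 0 := by
  ext y z
  simp only [Estar, Matrix.diagonal_mul, Matrix.mul_diagonal, adj, Amat, Matrix.of_apply,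
    Matrix.zero_apply]
  by_cases h1 : S.G.dist x y = i
  · by_cases h2 : S.G.dist x z = j
    · have h3 : S.G.dist y z ≠ 1 := by
        intro h3
        have a := S.conn.dist_triangle (u := x) (v := y) (w := z)
        have b := S.conn.dist_triangle (u := x) (v := z) (w := y)
        rw [SimpleGraph.dist_comm (u := z)] at b
        omega
      simp [h3]
    · simp [h2]
  · simp [h1]

theorem E_conj (i : ℕ) (hi : i ≤ S.D) : (S.E i)ᴴ = S.E i := by
  ext y z
  rw [Matrix.conjTranspose_apply]
  have h : S.E i z y = S.E i y z := congrFun (congrFun (S.hEsym i hi) y) z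
  rw [h]
  exact Complex.conj_eq_iff_im.2 (S.hEreal i hi y z)

open scoped ComplexOrder in
theorem E_tri (i j : ℕ) (hi : i ≤ S.D) (hj : j ≤ S.D) (h : i + 1 < j ∨ j + 1 < i) :
    S.E i * (S.Astar x * S.E j) = 0 := by
  have hD := S.hD3
  have hA : (S.Astar x)ᴴ = S.Astar x := by
    unfold Astar
    rw [Matrix.diagonal_conjTranspose]
    congr 1
    ext y
    simp only [Pi.star_apply, star_mul', RCLike.star_def, Complex.conj_natCast]
    rw [Complex.conj_eq_iff_im.2 (S.hEreal 1 (by omega) x y)]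
  rw [← Matrix.trace_conjTranspose_mul_self_eq_zero_iff]
  rw [Matrix.conjTranspose_mul, Matrix.conjTranspose_mul, hA, S.E_conj i hi, S.E_conj j hj]
  have e1 : S.E j * S.Astar x * S.E i * (S.E i * (S.Astar x * S.E j))
      = S.E j * (S.Astar x * S.E i * S.Astar x * S.E j) := by
    have := S.hEmul i hi i hi
    rw [if_pos rfl] at this
    calc _ = S.E j * (S.Astar x * (S.E i * S.E i) * S.Astar x * S.E j) := by noncomm_ring
      _ = _ := by rw [this]
  have e2 : S.Astar x * S.E i * S.Astar x * S.E j * S.E j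
      = S.Astar x * S.E i * S.Astar x * S.E j := by
    have := S.hEmul j hj j hj
    rw [if_pos rfl] at this
    rw [mul_assoc, this]
  rw [e1, Matrix.trace_mul_comm, e2]
  -- the trace is an entry of `E 1 * (E i ∘ E j) * E 1`
  have e3 : (S.Astar x * S.E i * S.Astar x * S.E j).trace
      = (Fintype.card X : ℂ) ^ 2 *
        ((S.E 1 * (Matrix.hadamard (S.E i) (S.E j) * S.E 1)) x x) := by
    simp only [Matrix.trace, Matrix.diag_apply]
    rw [Matrix.mul_apply, Finset.mul_sum]
    refine Finset.sum_congr rfl fun y _ => ?_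
    rw [Matrix.mul_apply, Matrix.mul_apply, Finset.mul_sum, Finset.mul_sum]
    refine Finset.sum_congr rfl fun z _ => ?_
    have h1 : S.E j z y = S.E j y z := congrFun (congrFun (S.hEsym j hj) y) z
    have h2 : S.E 1 z x = S.E 1 x z := congrFun (congrFun (S.hEsym 1 (by omega)) x) z
    simp only [Astar, Matrix.diagonal_mul, Matrix.mul_diagonal, Matrix.hadamard_apply, h1, h2]
    ring
  rw [e3, S.hKrein i hi j hj]
  have e4 : S.E 1 * (((Fintype.card X : ℂ))⁻¹ •
      ∑ h ∈ Finset.range (S.D + 1), (S.q h i j : ℂ) • S.E h) * S.E 1 = 0 := by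
    rw [Matrix.mul_smul, Matrix.smul_mul, Finset.mul_sum, Finset.sum_mul]
    rw [Finset.sum_eq_zero, smul_zero]
    intro k hk
    have hk' : k ≤ S.D := by simpa [Nat.lt_succ_iff] using hk
    rw [Matrix.mul_smul, Matrix.smul_mul, S.hEmul 1 (by omega) k hk']
    split_ifs with h5
    · subst h5
      rw [S.hq_zero 1 (by omega) i hi j hj (by omega)]; simp
    · simp
  rw [← mul_assoc, e4]
  simp

theorem invariant (W : Submodule ℂ (EuclideanSpace ℂ X))
    (hA : ∀ w ∈ W, Matrix.toEuclideanLin S.adj w ∈ W)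
    (hB : ∀ w ∈ W, Matrix.toEuclideanLin (S.Astar x) w ∈ W) : S.IsTModule x W := by
  intro M hM
  refine Algebra.adjoin_induction (p := fun M _ => ∀ w ∈ W, Matrix.toEuclideanLin M w ∈ W)
    ?_ ?_ ?_ ?_ hM
  · rintro M (rfl | rfl)
    · exact hA
    · exact hB
  · intro r w hw
    rw [Algebra.algebraMap_eq_smul_one, map_smul, LinearMap.smul_apply, tl_one]
    exact W.smul_mem r hw
  · intro M N _ _ h1 h2 w hw
    rw [map_add, LinearMap.add_apply]
    exact W.add_mem (h1 w hw) (h2 w hw)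
  · intro M N _ _ h1 h2 w hw
    rw [tl_mul]
    exact h1 _ (h2 w hw)

theorem Estar_mul (i j : ℕ) :
    S.Estar x i * S.Estar x j = if i = j then S.Estar x i else 0 := by
  unfold Estar
  rw [Matrix.diagonal_mul_diagonal]
  split_ifs with h
  · subst h; congr 1; ext y; simp
  · rw [← Matrix.diagonal_zero]; congr 1; ext y
    by_cases h1 : S.G.dist x y = i
    · simp [h1, h]
    · simp [h1]

theorem Estar_sum : ∑ i ∈ Finset.range (S.D + 1), S.Estar x i = 1 := by
  ext y z
  rw [Matrix.sum_apply]
  by_cases h : y = z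
  · subst h
    simp [Estar, S.dist_le x y]
  · simp [Estar, h]

theorem Estar_conj (i : ℕ) : (S.Estar x i)ᴴ = S.Estar x i := by
  unfold Estar
  rw [Matrix.diagonal_conjTranspose]
  congr 1
  ext y
  by_cases h : S.G.dist x y = i <;> simp [h]

theorem Estar_Astar : ∃ φ : ℕ → ℂ, ∀ i, S.Estar x i * S.Astar x = φ i • S.Estar x i := by
  have hD := S.hD3
  obtain ⟨f, hf⟩ := S.E_fun 1 (by omega)
  refine ⟨fun i => (Fintype.card X : ℂ) * f i, fun i => ?_⟩
  unfold Estar Astar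
  rw [Matrix.diagonal_mul_diagonal, ← Matrix.diagonal_smul]
  congr 1
  ext y
  by_cases h : S.G.dist x y = i
  · simp [hf, h]
  · simp [h]

theorem tds (W : Submodule ℂ (EuclideanSpace ℂ X)) (hW : S.IsIrredTModule x W) :
    ∃ φ : ℕ → ℂ, TDS S.D (Matrix.toEuclideanLin S.adj) (Matrix.toEuclideanLin (S.Astar x))
      (fun i => Matrix.toEuclideanLin (S.E i)) (fun i => Matrix.toEuclideanLin (S.Estar x i))
      (fun i => (S.θ i : ℂ)) φ W := by
  obtain ⟨φ, hφ⟩ := S.Estar_Astar x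
  refine ⟨φ, ?_, ?_, ?_, ?_, ?_, ?_, ?_, ?_, ?_, ?_, ?_, ?_, ?_⟩
  · intro v
    rw [← LinearMap.sum_apply, ← map_sum, S.hEsum, tl_one]
  · intro v
    rw [← LinearMap.sum_apply, ← map_sum, S.Estar_sum, tl_one]
  · intro i hi j hj v
    rw [← tl_mul, S.hEmul i hi j hj]
    split_ifs <;> simp
  · intro i hi j hj v
    rw [← tl_mul, S.Estar_mul]
    split_ifs <;> simp
  · intro i hi v
    rw [← tl_mul, S.E_adj i hi, map_smul, LinearMap.smul_apply]
  · intro i hi v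
    rw [← tl_mul, hφ, map_smul, LinearMap.smul_apply]
  · intro i hi j hj h v
    rw [← tl_mul, ← tl_mul, mul_assoc, S.E_tri x i j hi hj h]; simp
  · intro i hi j hj h v
    rw [← tl_mul, ← tl_mul, mul_assoc, S.Estar_tri x i j h]; simp
  · exact fun i hi => hW.1 _ (S.E_mem x i hi)
  · exact fun i hi => hW.1 _ (S.Estar_mem x i)
  · exact hW.1 _ (Algebra.subset_adjoin (by simp))
  · exact hW.1 _ (Algebra.subset_adjoin (by simp))
  · exact fun W' h a b => hW.2.2 W' h (S.invariant x W' a b)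

theorem EW_nat (W : Submodule ℂ (EuclideanSpace ℂ X)) (i : ℕ) (hi : i ≤ S.D) :
    S.EW W i = W.map (Matrix.toEuclideanLin (S.E i)) := by
  unfold EW
  rw [if_pos ⟨by omega, by omega⟩]; rfl

theorem EstarW_nat (W : Submodule ℂ (EuclideanSpace ℂ X)) (i : ℕ) (hi : i ≤ S.D) :
    S.EstarW x W i = W.map (Matrix.toEuclideanLin (S.Estar x i)) := by
  unfold EstarW
  rw [if_pos ⟨by omega, by omega⟩]; rfl

theorem map_ne_bot (W : Submodule ℂ (EuclideanSpace ℂ X))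
    (f : EuclideanSpace ℂ X →ₗ[ℂ] EuclideanSpace ℂ X) :
    W.map f ≠ ⊥ ↔ ∃ w ∈ W, f w ≠ 0 := by
  rw [Submodule.ne_bot_iff]
  simp

theorem orth (M N : Matrix X X ℂ) (hM : Mᴴ = M) (hMN : M * N = 0)
    (u v : EuclideanSpace ℂ X) :
    ⟪Matrix.toEuclideanLin M u, Matrix.toEuclideanLin N v⟫ = 0 := by
  rw [← LinearMap.adjoint_inner_right, ← Matrix.toEuclideanLin_conjTranspose_eq_adjoint, hM,
    ← tl_mul, hMN]
  simp

/-- A set of naturals with least element `a` and without gaps is an interval. -/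
theorem interval_set (D a n : ℕ) (s : Set ℕ) (hs : ∀ i ∈ s, i ≤ D) (ha : IsLeast s a)
    (hc : ∀ i k j, i < k → k < j → i ∈ s → j ∈ s → k ∈ s) (hn : n + 1 = s.ncard) :
    s = Set.Icc a (a + n) := by
  have hfin : s.Finite := (Set.finite_Iic D).subset hs
  obtain ⟨b, hb, hb'⟩ := hfin.exists_maximal ⟨a, ha.1⟩
  have hmax : ∀ i ∈ s, i ≤ b := fun i hi => by
    by_contra h; exact h (hb' hi (by omega))
  have hab := ha.2 hb
  have he : s = Set.Icc a b := by
    ext i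
    refine ⟨fun hi => ⟨ha.2 hi, hmax i hi⟩, fun ⟨h1, h2⟩ => ?_⟩
    rcases Nat.eq_or_lt_of_le h1 with h1 | h1
    · exact h1 ▸ ha.1
    rcases Nat.eq_or_lt_of_le h2 with h2 | h2
    · exact h2 ▸ hb
    exact hc a i b h1 h2 ha.1 hb
  have : s.ncard = b + 1 - a := by
    rw [he, ← Finset.coe_Icc, Set.ncard_coe_finset, Nat.card_Icc]
  rw [he]
  congr 1
  omega

theorem sup_eq {D : ℕ} {A B : EuclideanSpace ℂ X →ₗ[ℂ] EuclideanSpace ℂ X}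
    {P Q : ℕ → EuclideanSpace ℂ X →ₗ[ℂ] EuclideanSpace ℂ X} {θ φ : ℕ → ℂ}
    {W : Submodule ℂ (EuclideanSpace ℂ X)} (H : TDS D A B P Q θ φ W)
    (F : ℤ → Submodule ℂ (EuclideanSpace ℂ X)) (hF : ∀ i : ℕ, i ≤ D → F i = W.map (P i))
    (a n : ℕ) (han : a + n ≤ D) (hne : ∀ i : ℕ, i ≤ D → (F i ≠ ⊥ ↔ a ≤ i ∧ i ≤ a + n)) :
    (⨆ h : Fin (n + 1), F (a + h)) = W := by
  apply le_antisymm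
  · refine iSup_le fun h => ?_
    have hh := h.2
    have := hF (a + h) (by omega)
    push_cast at this
    rw [this]
    rintro _ ⟨w, hw, rfl⟩
    exact H.PW _ (by omega) w hw
  · intro w hw
    rw [← H.Psum w]
    refine Submodule.sum_mem _ fun i hi => ?_
    have hi' : i ≤ D := by simpa [Nat.lt_succ_iff] using hi
    have hmem : P i w ∈ F i := by rw [hF i hi']; exact ⟨w, hw, rfl⟩
    by_cases h0 : F i = ⊥
    · rw [h0, Submodule.mem_bot] at hmem
      rw [hmem]; exact Submodule.zero_mem _
    · have h1 := (hne i hi').1 h0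
      refine Submodule.mem_iSup_of_mem (⟨i - a, by omega⟩ : Fin (n + 1)) ?_
      have : ((a : ℤ) + ((i - a : ℕ) : ℤ)) = i := by omega
      simpa only [this] using hmem

end QPolyDRG

open QPolyDRG in
/-- Basic structure of an irreducible `T`-module `W` with endpoint `ρ`, dual endpoint `τ`,
and diameter `d`: `ρ + d ≤ D`, `τ + d ≤ D`, `E*_i W ≠ 0` iff `ρ ≤ i ≤ ρ + d`,
`W = E*_ρ W + ⋯ + E*_{ρ+d} W` (orthogonal direct sum), `E_i W ≠ 0` iff `τ ≤ i ≤ τ + d`,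
and `W = E_τ W + ⋯ + E_{τ+d} W` (orthogonal direct sum). -/
theorem drg_tmodule_structure {X : Type*} [Fintype X] [DecidableEq X] (S : QPolyDRG X) (x : X)
    (W : Submodule ℂ (EuclideanSpace ℂ X)) (hW : S.IsIrredTModule x W)
    (ρ τ d : ℕ)
    (hρ : IsLeast {i : ℕ | i ≤ S.D ∧ S.EstarW x W i ≠ ⊥} ρ)
    (hτ : IsLeast {i : ℕ | i ≤ S.D ∧ S.EW W i ≠ ⊥} τ)
    (hd : d + 1 = Set.ncard {i : ℕ | i ≤ S.D ∧ S.EstarW x W i ≠ ⊥}) :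
    ρ + d ≤ S.D ∧ τ + d ≤ S.D ∧
    (∀ i : ℕ, i ≤ S.D → (S.EstarW x W i ≠ ⊥ ↔ ρ ≤ i ∧ i ≤ ρ + d)) ∧
    ((⨆ h : Fin (d + 1), S.EstarW x W (ρ + h)) = W ∧
      ∀ h h' : Fin (d + 1), h ≠ h' → ∀ u ∈ S.EstarW x W (ρ + h), ∀ v ∈ S.EstarW x W (ρ + h'),
        ⟪u, v⟫ = 0) ∧
    (∀ i : ℕ, i ≤ S.D → (S.EW W i ≠ ⊥ ↔ τ ≤ i ∧ i ≤ τ + d)) ∧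
    ((⨆ h : Fin (d + 1), S.EW W (τ + h)) = W ∧
      ∀ h h' : Fin (d + 1), h ≠ h' → ∀ u ∈ S.EW W (τ + h), ∀ v ∈ S.EW W (τ + h'),
        ⟪u, v⟫ = 0) := by
  obtain ⟨φ, H⟩ := S.tds x W hW
  have hs : ∀ i ≤ S.D, (S.EstarW x W i ≠ ⊥ ↔ ∃ w ∈ W, Matrix.toEuclideanLin (S.Estar x i) w ≠ 0) :=
    fun i hi => by rw [S.EstarW_nat x W i hi, map_ne_bot]
  have he : ∀ i ≤ S.D, (S.EW W i ≠ ⊥ ↔ ∃ w ∈ W, Matrix.toEuclideanLin (S.E i) w ≠ 0) :=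
    fun i hi => by rw [S.EW_nat W i hi, map_ne_bot]
  have hI := interval_set S.D ρ d _ (fun i hi => hi.1) hρ (by
    rintro i k j hik hkj ⟨hi, hi'⟩ ⟨hj, hj'⟩
    exact ⟨by omega, (hs k (by omega)).2 (H.symm.interval hik hkj hj ((hs i hi).1 hi')
      ((hs j hj).1 hj'))⟩) hd
  obtain ⟨δ, hδ⟩ : ∃ δ, δ + 1 = Set.ncard {i : ℕ | i ≤ S.D ∧ S.EW W i ≠ ⊥} := by
    have hfin : Set.Finite {i : ℕ | i ≤ S.D ∧ S.EW W i ≠ ⊥} :=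
      (Set.finite_Iic S.D).subset fun i hi => hi.1
    have := (Set.ncard_pos hfin).2 ⟨τ, hτ.1⟩
    exact ⟨_, Nat.sub_add_cancel this⟩
  have hJ := interval_set S.D τ δ _ (fun i hi => hi.1) hτ (by
    rintro i k j hik hkj ⟨hi, hi'⟩ ⟨hj, hj'⟩
    exact ⟨by omega, (he k (by omega)).2 (H.interval hik hkj hj ((he i hi).1 hi')
      ((he j hj).1 hj'))⟩) hδ
  have hI' : ∀ i : ℕ, (i ≤ S.D ∧ S.EstarW x W i ≠ ⊥) ↔ ρ ≤ i ∧ i ≤ ρ + d :=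
    fun i => Set.ext_iff.1 hI i
  have hJ' : ∀ i : ℕ, (i ≤ S.D ∧ S.EW W i ≠ ⊥) ↔ τ ≤ i ∧ i ≤ τ + δ :=
    fun i => Set.ext_iff.1 hJ i
  have hs0 : ∀ i ≤ S.D, ¬ (ρ ≤ i ∧ i ≤ ρ + d) →
      ∀ w ∈ W, Matrix.toEuclideanLin (S.Estar x i) w = 0 := by
    intro i hi hn w hw
    by_contra h
    exact hn ((hI' i).1 ⟨hi, (hs i hi).2 ⟨w, hw, h⟩⟩)
  have he0 : ∀ i ≤ S.D, ¬ (τ ≤ i ∧ i ≤ τ + δ) →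
      ∀ w ∈ W, Matrix.toEuclideanLin (S.E i) w = 0 := by
    intro i hi hn w hw
    by_contra h
    exact hn ((hJ' i).1 ⟨hi, (he i hi).2 ⟨w, hw, h⟩⟩)
  have hρd := (hI' (ρ + d)).2 (by omega)
  have hτδ := (hJ' (τ + δ)).2 (by omega)
  have h1 : τ + δ ≤ τ + d := H.core (ρ := ρ) (τ := τ) (d := d) hτ.1.1
    (fun h hh hlt => hs0 h hh (by omega)) (fun h hh hlt => hs0 h hh (by omega))
    ((he τ hτ.1.1).1 hτ.1.2) (τ + δ) hτδ.1 ((he _ hτδ.1).1 hτδ.2)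
  have h2 : ρ + d ≤ ρ + δ := H.symm.core (ρ := τ) (τ := ρ) (d := δ) hρ.1.1
    (fun h hh hlt => he0 h hh (by omega)) (fun h hh hlt => he0 h hh (by omega))
    ((hs ρ hρ.1.1).1 hρ.1.2) (ρ + d) hρd.1 ((hs _ hρd.1).1 hρd.2)
  obtain rfl : δ = d := by omega
  have hIc : ∀ i : ℕ, i ≤ S.D → (S.EstarW x W i ≠ ⊥ ↔ ρ ≤ i ∧ i ≤ ρ + δ) := fun i hi =>
    ⟨fun h => (hI' i).1 ⟨hi, h⟩, fun h => ((hI' i).2 h).2⟩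
  have hJc : ∀ i : ℕ, i ≤ S.D → (S.EW W i ≠ ⊥ ↔ τ ≤ i ∧ i ≤ τ + δ) := fun i hi =>
    ⟨fun h => (hJ' i).1 ⟨hi, h⟩, fun h => ((hJ' i).2 h).2⟩
  refine ⟨hρd.1, hτδ.1, hIc, ⟨?_, ?_⟩, hJc, ⟨?_, ?_⟩⟩
  · exact sup_eq H.symm (S.EstarW x W) (fun i hi => S.EstarW_nat x W i hi) ρ δ hρd.1 hIc
  · intro h h' hne u hu v hv
    have hh := h.2
    have hh' := h'.2
    have e1 := S.EstarW_nat x W (ρ + h) (by omega)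
    have e2 := S.EstarW_nat x W (ρ + h') (by omega)
    push_cast at e1 e2
    rw [e1] at hu
    rw [e2] at hv
    obtain ⟨u, -, rfl⟩ := hu
    obtain ⟨v, -, rfl⟩ := hv
    have hv : (h : ℕ) ≠ h' := fun hc => hne (Fin.ext hc)
    exact orth _ _ (S.Estar_conj x _) (by rw [S.Estar_mul, if_neg (by omega)]) u v
  · exact sup_eq H (S.EW W) (fun i hi => S.EW_nat W i hi) τ δ hτδ.1 hJc
  · intro h h' hne u hu v hv
    have hh := h.2
    have hh' := h'.2
    have e1 := S.EW_nat W (τ + h) (by omega)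
    have e2 := S.EW_nat W (τ + h') (by omega)
    push_cast at e1 e2
    rw [e1] at hu
    rw [e2] at hv
    obtain ⟨u, -, rfl⟩ := hu
    obtain ⟨v, -, rfl⟩ := hv
    have hv : (h : ℕ) ≠ h' := fun hc => hne (Fin.ext hc)
    exact orth _ _ (S.E_conj _ (by omega))
      (by rw [S.hEmul _ (by omega) _ (by omega), if_neg (by omega)]) u v


end
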